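/- The Minkowski reduction region M is a polyhedral cone: there exists a finite set T of pairs (i, v), with i ∈ {1,…,N} and v ∈ ℤ^N satisfying gcd(v_i,…,v_N) = 1, such that M equals the set of real symmetric N×N matrices G satisfying g_{i,i+1} ≥ 0 for i = 1,…,N−1 together with vᵀGv ≥ g_{i,i} for every pair (i,v) ∈ T. -/

import Mathlib

open Matrix

/-- The quadratic form `vᵀ G v` evaluated at an integer vector `v`. -/
def intQuadForm {N : ℕ} (G : Matrix (Fin N) (Fin N) ℝ) (v : Fin N → ℤ) : ℝ :=
  (fun i => (v i : ℝ)) ⬝ᵥ G.mulVec fun i => (v i : ℝ)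

/-- The gcd condition `gcd(v_i, …, v_N) = 1` for an integer vector `v` and an
index `i`. -/
def GcdTailOne {N : ℕ} (i : Fin N) (v : Fin N → ℤ) : Prop :=
  Finset.gcd (Finset.Ici i) v = 1

/-- The Minkowski reduction region `M`: symmetric matrices `G` with
`vᵀGv ≥ g_{i,i}` whenever `gcd(v_i,…,v_N) = 1`, and `g_{i,i+1} ≥ 0`. -/
def MinkowskiRegion (N : ℕ) : Set (Matrix (Fin N) (Fin N) ℝ) :=
  {G | G.IsSymm ∧
    (∀ i : Fin N, ∀ v : Fin N → ℤ, GcdTailOne i v → G i i ≤ intQuadForm G v) ∧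
    (∀ i : Fin N, ∀ h : (i : ℕ) + 1 < N, 0 ≤ G i ⟨(i : ℕ) + 1, h⟩)}

namespace MinkowskiReduction

/-- The quadratic form of the top left `N × N` block of `g`. -/
def blockForm (N : ℕ) (g : ℕ → ℕ → ℝ) (x : ℕ → ℝ) : ℝ :=
  ∑ a ∈ Finset.range N, ∑ b ∈ Finset.range N, g a b * x a * x b

/-- The entries `v_i, …, v_{N-1}` have no common divisor other than units. -/
def TailPrimitive (i N : ℕ) (v : ℕ → ℤ) : Prop :=
  ∀ e : ℤ, (∀ l, i ≤ l → l < N → e ∣ v l) → e ∣ 1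

/-- The Minkowski inequalities for integer vectors with entries of size at most `B`. -/
def BoundedReduced (N : ℕ) (B : ℝ) (g : ℕ → ℕ → ℝ) : Prop :=
  ∀ i < N, ∀ v : ℕ → ℤ, TailPrimitive i N v → (∀ l < N, |(v l : ℝ)| ≤ B) →
    g i i ≤ blockForm N g (fun l => v l)

/-- Iterated Schur complements of `g` with respect to its first `s` diagonal entries. -/
noncomputable def schur (g : ℕ → ℕ → ℝ) : ℕ → ℕ → ℕ → ℝ
  | 0 => g
  | s + 1 => fun a b => schur g s a b - schur g s a s * schur g s s b / schur g s s s

/-- The pivots, that is, the squared lengths of the Gram–Schmidt vectors. -/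
noncomputable def pivot (g : ℕ → ℕ → ℝ) (s : ℕ) : ℝ := schur g s s s

/-- The Gram–Schmidt coefficients. -/
noncomputable def coeff (g : ℕ → ℕ → ℝ) (s b : ℕ) : ℝ := schur g s s b / pivot g s

/-- The `s`-th coordinate of `x` with respect to a unitriangular change of basis. -/
def coord (N : ℕ) (μ : ℕ → ℕ → ℝ) (s : ℕ) (x : ℕ → ℝ) : ℝ :=
  x s + ∑ b ∈ Finset.Ico (s + 1) N, μ s b * x b

lemma schur_symm {g : ℕ → ℕ → ℝ} (hg : ∀ a b, g a b = g b a) (k a b : ℕ) :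
    schur g k a b = schur g k b a := by
  induction k generalizing a b with
  | zero => exact hg a b
  | succ k ih =>
    simp only [schur]
    rw [ih a b, ih a k, ih k b]
    ring

lemma schur_eq_zero {g : ℕ → ℕ → ℝ} {k : ℕ} (hp : ∀ s < k, pivot g s ≠ 0) {a : ℕ} (ha : a < k)
    (b : ℕ) : schur g k a b = 0 := by
  induction k generalizing a b with
  | zero => omega
  | succ k ih =>
    simp only [schur]
    rcases Nat.lt_succ_iff_lt_or_eq.1 ha with h | rfl
    · rw [ih (fun s hs => hp s (by omega)) h, ih (fun s hs => hp s (by omega)) h]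
      simp
    · have := hp a (by omega)
      unfold pivot at this
      field_simp
      simp

lemma coord_coeff {g : ℕ → ℕ → ℝ} (hg : ∀ a b, g a b = g b a) {N s : ℕ} (hs : s < N)
    (hp : ∀ t ≤ s, pivot g t ≠ 0) (x : ℕ → ℝ) :
    ∑ b ∈ Finset.range N, coeff g s b * x b = coord N (coeff g) s x := by
  rw [Finset.range_eq_Ico, ← Finset.sum_Ico_consecutive _ (Nat.zero_le s) hs.le,
    Finset.sum_eq_sum_Ico_succ_bot hs, coord]
  have h1 : ∑ b ∈ Finset.Ico 0 s, coeff g s b * x b = 0 := by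
    refine Finset.sum_eq_zero fun b hb => ?_
    rw [coeff, schur_symm hg, schur_eq_zero (fun t ht => hp t ht.le) (Finset.mem_Ico.1 hb).2]
    simp
  have h2 : coeff g s s = 1 := div_self (hp s le_rfl)
  rw [h1, h2]
  ring

lemma blockForm_schur_succ {g : ℕ → ℕ → ℝ} (hg : ∀ a b, g a b = g b a) {N s : ℕ} (hs : s < N)
    (hp : ∀ t ≤ s, pivot g t ≠ 0) (x : ℕ → ℝ) :
    blockForm N (schur g s) x =
      pivot g s * coord N (coeff g) s x ^ 2 + blockForm N (schur g (s + 1)) x := by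
  rw [← coord_coeff hg hs hp, sq, Finset.sum_mul_sum, Finset.mul_sum, blockForm, blockForm,
    ← Finset.sum_add_distrib]
  refine Finset.sum_congr rfl fun a _ => ?_
  rw [Finset.mul_sum, ← Finset.sum_add_distrib]
  refine Finset.sum_congr rfl fun b _ => ?_
  have := hp s le_rfl
  simp only [schur, coeff]
  unfold pivot at *
  rw [schur_symm hg s a s]
  field_simp
  ring

lemma blockForm_eq_sum {g : ℕ → ℕ → ℝ} (hg : ∀ a b, g a b = g b a) {N k : ℕ} (hk : k ≤ N)
    (hp : ∀ t < k, pivot g t ≠ 0) (x : ℕ → ℝ) :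
    blockForm N g x =
      ∑ s ∈ Finset.range k, pivot g s * coord N (coeff g) s x ^ 2
        + blockForm N (schur g k) x := by
  induction k with
  | zero => simp [schur]
  | succ k ih =>
    rw [ih (by omega) (fun t ht => hp t (by omega)), Finset.sum_range_succ,
      blockForm_schur_succ hg hk (fun t ht => hp t (by omega))]
    ring

lemma blockForm_eq_sum_self {g : ℕ → ℕ → ℝ} (hg : ∀ a b, g a b = g b a) {N : ℕ}
    (hp : ∀ t < N, pivot g t ≠ 0) (x : ℕ → ℝ) :
    blockForm N g x = ∑ s ∈ Finset.range N, pivot g s * coord N (coeff g) s x ^ 2 := by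
  rw [blockForm_eq_sum hg le_rfl hp, add_eq_left]
  refine Finset.sum_eq_zero fun a ha => Finset.sum_eq_zero fun b _ => ?_
  rw [schur_eq_zero hp (Finset.mem_range.1 ha)]
  simp

lemma blockForm_succ_eq_sum {g : ℕ → ℕ → ℝ} (hg : ∀ a b, g a b = g b a) {k : ℕ}
    (hp : ∀ t < k, pivot g t ≠ 0) (x : ℕ → ℝ) :
    blockForm (k + 1) g x =
      ∑ s ∈ Finset.range k, pivot g s * coord (k + 1) (coeff g) s x ^ 2
        + pivot g k * x k ^ 2 := by
  rw [blockForm_eq_sum hg (Nat.le_succ k) hp, add_right_inj, blockForm, Finset.sum_range_succ,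
    Finset.sum_range_succ]
  have h1 : ∑ a ∈ Finset.range k, ∑ b ∈ Finset.range (k + 1), schur g k a b * x a * x b = 0 :=
    Finset.sum_eq_zero fun a ha => Finset.sum_eq_zero fun b _ => by
      rw [schur_eq_zero hp (Finset.mem_range.1 ha)]; simp
  have h2 : ∑ b ∈ Finset.range k, schur g k k b * x k * x b = 0 :=
    Finset.sum_eq_zero fun b hb => by
      rw [schur_symm hg, schur_eq_zero hp (Finset.mem_range.1 hb)]; simp
  rw [h1, h2, pivot]
  ring

lemma coord_congr {N s : ℕ} {μ : ℕ → ℕ → ℝ} {x y : ℕ → ℝ} (h : ∀ l, s ≤ l → x l = y l) :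
    coord N μ s x = coord N μ s y := by
  unfold coord
  rw [h s le_rfl]
  congr 1
  refine Finset.sum_congr rfl fun b hb => ?_
  rw [h b (by have := Finset.mem_Ico.1 hb; omega)]

lemma coord_sub (N s : ℕ) (μ : ℕ → ℕ → ℝ) (x y : ℕ → ℝ) :
    coord N μ s (fun l => x l - y l) = coord N μ s x - coord N μ s y := by
  simp only [coord, mul_sub, Finset.sum_sub_distrib]
  ring

/-- Rounding the first `m` entries successively makes the first `m` coordinates lie in `[0, 1)`. -/
lemma exists_rounding (N : ℕ) (μ : ℕ → ℕ → ℝ) (m : ℕ) (w : ℕ → ℤ) :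
    ∃ v : ℕ → ℤ, (∀ l, m ≤ l → v l = w l) ∧
      ∀ s < m, 0 ≤ coord N μ s (fun l => v l) ∧ coord N μ s (fun l => v l) < 1 := by
  induction m generalizing w with
  | zero => exact ⟨w, by simp, by simp⟩
  | succ m ih =>
    set S : ℝ := ∑ b ∈ Finset.Ico (m + 1) N, μ m b * w b with hS
    obtain ⟨v, hv, hc⟩ := ih (Function.update w m (-⌊S⌋))
    refine ⟨v, fun l hl => ?_, fun s hs => ?_⟩
    · rw [hv l (by omega), Function.update_of_ne (by omega)]
    · rcases Nat.lt_succ_iff_lt_or_eq.1 hs with h | rfl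
      · exact hc s h
      · have : coord N μ s (fun l => v l) = Int.fract S := by
          rw [coord, hv s le_rfl, Function.update_self, Int.fract, hS]
          have : ∑ b ∈ Finset.Ico (s + 1) N, μ s b * (v b : ℝ)
              = ∑ b ∈ Finset.Ico (s + 1) N, μ s b * w b := by
            refine Finset.sum_congr rfl fun b hb => ?_
            have := Finset.mem_Ico.1 hb
            rw [hv b (by omega), Function.update_of_ne (by omega)]
          rw [this]
          push_cast
          ring
        rw [this]
        exact ⟨Int.fract_nonneg S, Int.fract_lt_one S⟩

lemma abs_le_of_coord_le {N : ℕ} {μ : ℕ → ℕ → ℝ} {C K : ℝ} (hC : 0 ≤ C) (hK : 0 ≤ K)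
    (hμ : ∀ s b, s < b → b < N → |μ s b| ≤ C) {x : ℕ → ℝ}
    (hx : ∀ s < N, |coord N μ s x| ≤ K) {s : ℕ} (hs : s < N) : |x s| ≤ K * (2 + C) ^ N := by
  have key : ∀ j ≤ N, ∑ b ∈ Finset.Ico (N - j) N, |x b| + K ≤ K * (2 + C) ^ j := by
    intro j hj
    induction j with
    | zero => simp
    | succ j ih =>
      have ih := ih (by omega)
      have e : N - j = N - (j + 1) + 1 := by omega
      rw [e] at ih
      have ht : N - (j + 1) < N := by omega
      generalize N - (j + 1) = t at *
      rw [Finset.sum_eq_sum_Ico_succ_bot ht]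
      have h1 : |x t| ≤ K + C * ∑ b ∈ Finset.Ico (t + 1) N, |x b| := by
        have h2 : x t = coord N μ t x - ∑ b ∈ Finset.Ico (t + 1) N, μ t b * x b := by
          rw [coord]; ring
        rw [h2]
        refine (abs_sub _ _).trans (add_le_add (hx t ht) ?_)
        refine (Finset.abs_sum_le_sum_abs _ _).trans ?_
        rw [Finset.mul_sum]
        refine Finset.sum_le_sum fun b hb => ?_
        rw [abs_mul]
        have := Finset.mem_Ico.1 hb
        exact mul_le_mul_of_nonneg_right (hμ t b (by omega) this.2) (abs_nonneg _)
      have h3 : 0 ≤ ∑ b ∈ Finset.Ico (t + 1) N, |x b| := Finset.sum_nonneg fun _ _ => abs_nonneg _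
      rw [pow_succ]
      nlinarith [mul_nonneg hC hK, mul_le_mul_of_nonneg_right ih (by linarith : 0 ≤ 2 + C)]
  have h := key N le_rfl
  rw [Nat.sub_self] at h
  have := Finset.single_le_sum (f := fun b => |x b|) (s := Finset.Ico 0 N)
    (fun _ _ => abs_nonneg _) (Finset.mem_Ico.2 ⟨Nat.zero_le s, hs⟩)
  linarith

/-- A pigeonhole argument in the style of Dirichlet's theorem on simultaneous approximation. -/
lemma exists_small_coord (μ : ℕ → ℕ → ℝ) (k : ℕ) {R : ℕ} (hR : 0 < R) :
    ∃ v : ℕ → ℤ, 1 ≤ v k ∧ v k ≤ (R : ℤ) ^ k ∧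
      ∀ s < k, |coord (k + 1) μ s (fun l => v l)| ≤ 1 / R := by
  choose u hu hc using fun q : ℕ => exists_rounding (k + 1) μ k (fun _ => (q : ℤ))
  have hR' : (0 : ℝ) < R := Nat.cast_pos.2 hR
  let f : Fin (R ^ k + 1) → (Fin k → Fin R) := fun q s =>
    ⟨⌊R * coord (k + 1) μ s (fun l => u q l)⌋₊, by
      have := hc q s s.2
      rw [Nat.floor_lt (by have := this.1; positivity)]
      nlinarith [this.2]⟩
  obtain ⟨p, q, hpq, hf⟩ := Fintype.exists_ne_map_eq_of_card_lt f (by simp)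
  wlog hlt : p < q generalizing p q
  · exact this q p hpq.symm hf.symm (lt_of_le_of_ne (not_lt.1 hlt) hpq.symm)
  have hlt' : (p : ℕ) < q := hlt
  have hq := q.2
  refine ⟨fun l => u q l - u p l, ?_, ?_, fun s hs => ?_⟩
  · simp only [hu _ k le_rfl]; omega
  · simp only [hu _ k le_rfl]
    have : ((q : ℕ) : ℤ) ≤ (R : ℤ) ^ k := by exact_mod_cast Nat.lt_succ_iff.1 hq
    omega
  · push_cast
    rw [coord_sub]
    have h := congrArg Fin.val (congrFun hf ⟨s, hs⟩)
    simp only [f] at h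
    have hp1 := Nat.floor_le (mul_nonneg hR'.le (hc p s hs).1)
    have hp2 := Nat.lt_floor_add_one (R * coord (k + 1) μ s (fun l => u p l))
    have hq1 := Nat.floor_le (mul_nonneg hR'.le (hc q s hs).1)
    have hq2 := Nat.lt_floor_add_one (R * coord (k + 1) μ s (fun l => u q l))
    rw [h] at hp1 hp2
    rw [abs_le, le_div_iff₀ hR', neg_le_iff_add_nonneg, ← sub_nonneg]
    have e : (1 : ℝ) / R * R = 1 := by field_simp
    constructor
    · rw [sub_zero]
      by_contra! hneg
      nlinarith
    · nlinarith

lemma tailPrimitive_iff_gcd {i N : ℕ} {v : ℕ → ℤ} :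
    TailPrimitive i N v ↔ (Finset.Ico i N).gcd v = 1 := by
  constructor
  · intro h
    have h1 := h ((Finset.Ico i N).gcd v) fun l h1 h2 =>
      Finset.gcd_dvd (Finset.mem_Ico.2 ⟨h1, h2⟩)
    rw [← Finset.normalize_gcd]
    exact normalize_eq_one.2 (isUnit_of_dvd_one h1)
  · intro h e he
    rw [← h]
    exact Finset.dvd_gcd fun l hl => he l (Finset.mem_Ico.1 hl).1 (Finset.mem_Ico.1 hl).2

lemma TailPrimitive.congr {i N : ℕ} {v w : ℕ → ℤ} (h : TailPrimitive i N v)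
    (hvw : ∀ l, i ≤ l → l < N → v l = w l) : TailPrimitive i N w :=
  fun e he => h e fun l h1 h2 => by rw [hvw l h1 h2]; exact he l h1 h2

lemma exists_primitive_small_coord (μ : ℕ → ℕ → ℝ) {m k : ℕ} (hmk : m ≤ k) {R : ℕ} (hR : 0 < R) :
    ∃ v : ℕ → ℤ, TailPrimitive m (k + 1) v ∧ |(v k : ℝ)| ≤ (R : ℝ) ^ k ∧
      (∀ s, m ≤ s → s < k → |coord (k + 1) μ s (fun l => v l)| ≤ 1 / R) ∧
      ∀ s < m, |coord (k + 1) μ s (fun l => v l)| ≤ 1 := by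
  obtain ⟨u, hu1, hu2, huc⟩ := exists_small_coord μ k hR
  obtain ⟨w, hw, hw1⟩ := Finset.extract_gcd u
    (s := Finset.Ico m (k + 1)) ⟨k, Finset.mem_Ico.2 ⟨hmk, by omega⟩⟩
  set e := (Finset.Ico m (k + 1)).gcd u
  have hw : ∀ l, m ≤ l → l < k + 1 → u l = e * w l := fun l h1 h2 =>
    hw l (Finset.mem_Ico.2 ⟨h1, h2⟩)
  have he : e ≠ 0 := by
    intro h
    have := hw k hmk (by omega)
    rw [h, zero_mul] at this
    omega
  have he1 : (1 : ℝ) ≤ |(e : ℝ)| := by exact_mod_cast Int.one_le_abs he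
  obtain ⟨v, hv, hvc⟩ := exists_rounding (k + 1) μ m w
  refine ⟨v, (tailPrimitive_iff_gcd.2 hw1).congr fun l h1 _ => (hv l h1).symm, ?_,
    fun s h1 h2 => ?_, fun s hs => ?_⟩
  · rw [hv k hmk]
    have h1 : |(u k : ℝ)| ≤ (R : ℝ) ^ k := by
      rw [abs_of_nonneg (by exact_mod_cast (by omega : 0 ≤ u k))]
      exact_mod_cast hu2
    rw [hw k hmk (by omega), Int.cast_mul, abs_mul] at h1
    nlinarith [abs_nonneg (w k : ℝ)]
  · have h3 : coord (k + 1) μ s (fun l => u l) = e * coord (k + 1) μ s (fun l => v l) := by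
      rw [coord, coord, mul_add, Finset.mul_sum, hv s h1, hw s h1 (by omega), Int.cast_mul]
      congr 1
      refine Finset.sum_congr rfl fun b hb => ?_
      have := Finset.mem_Ico.1 hb
      rw [hv b (by omega), hw b (by omega) this.2, Int.cast_mul]
      ring
    have h4 := huc s h2
    rw [h3, abs_mul] at h4
    nlinarith [abs_nonneg (coord (k + 1) μ s (fun l => v l))]
  · have := hvc s hs
    rw [abs_of_nonneg this.1]
    exact this.2.le

lemma exists_gap {f : ℕ → ℝ} {r : ℝ} (hr : 1 ≤ r) (k : ℕ) (hf0 : ∀ s ≤ k, 0 ≤ f s)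
    (hf : ∀ s t, s ≤ t → t ≤ k → f s ≤ f t) :
    ∃ m ≤ k, (∀ s < m, r * f s ≤ f m) ∧ f k ≤ r ^ k * f m := by
  induction k with
  | zero => exact ⟨0, le_rfl, by simp, by simp⟩
  | succ k ih =>
    by_cases h : r * f k ≤ f (k + 1)
    · refine ⟨k + 1, le_rfl, fun s hs => ?_, ?_⟩
      · have := hf s k (by omega) (by omega)
        nlinarith
      · exact le_mul_of_one_le_left (hf0 _ le_rfl) (one_le_pow₀ hr)
    · obtain ⟨m, hm, h1, h2⟩ := ih (fun s hs => hf0 s (by omega))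
        (fun s t h1 h2 => hf s t h1 (by omega))
      refine ⟨m, by omega, h1, ?_⟩
      rw [pow_succ]
      push Not at h
      nlinarith

lemma BoundedReduced.of_le {N n : ℕ} {B : ℝ} (hB : 0 ≤ B) {g : ℕ → ℕ → ℝ}
    (h : BoundedReduced N B g) (hn : n ≤ N) : BoundedReduced n B g := by
  intro i hi v hv hvB
  have h1 := h i (by omega) (fun l => if l < n then v l else 0)
    (fun e he => hv e fun l h1 h2 => by simpa [h2] using he l h1 (by omega))
    (fun l _ => by
      by_cases hl : l < n
      · simpa [hl] using hvB l hl
      · simpa [hl] using hB)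
  refine h1.trans_eq ?_
  have hsub : Finset.range n ⊆ Finset.range N := Finset.range_subset_range.2 hn
  unfold blockForm
  rw [← Finset.sum_subset hsub]
  · refine Finset.sum_congr rfl fun a ha => ?_
    rw [← Finset.sum_subset hsub]
    · refine Finset.sum_congr rfl fun b hb => ?_
      simp [Finset.mem_range.1 ha, Finset.mem_range.1 hb]
    · intro b _ hb
      simp [show ¬ b < n by simpa using hb]
  · intro a _ ha
    simp [show ¬ a < n by simpa using ha]

lemma blockForm_single_add {g : ℕ → ℕ → ℝ} (hg : ∀ a b, g a b = g b a) {N a b : ℕ} (ha : a < N)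
    (hb : b < N) (t : ℝ) :
    blockForm N g (fun l => (if l = b then 1 else 0) + t * (if l = a then 1 else 0)) =
      g b b + 2 * t * g a b + t ^ 2 * g a a := by
  have ha' := Finset.mem_range.2 ha
  have hb' := Finset.mem_range.2 hb
  simp only [blockForm, mul_add, mul_ite, mul_one, mul_zero, Finset.sum_add_distrib,
    Finset.sum_ite_eq', ha', hb', if_true, add_mul, ite_mul, zero_mul]
  rw [hg b a]
  ring

lemma BoundedReduced.diag_le_add {N : ℕ} {B : ℝ} (hB : 1 ≤ B) {g : ℕ → ℕ → ℝ}
    (hg : ∀ a b, g a b = g b a) (h : BoundedReduced N B g) {i a b : ℕ} (hib : i ≤ b) (hab : a < b)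
    (hb : b < N) {t : ℤ} (ht : |t| ≤ 1) :
    g i i ≤ g b b + 2 * t * g a b + t ^ 2 * g a a := by
  rw [← blockForm_single_add hg (hab.trans hb) hb t]
  have := h i (by omega) (fun l => (if l = b then 1 else 0) + t * (if l = a then 1 else 0))
    (fun e he => by simpa [hab.ne'] using he b hib hb) (fun l _ => by
      rcases eq_or_ne l b with rfl | h1
      · simpa [hab.ne'] using hB
      · rcases eq_or_ne l a with rfl | h2
        · have : |(t : ℝ)| ≤ 1 := by exact_mod_cast ht
          simpa [h1] using this.trans hB
        · simpa [h1, h2] using zero_le_one.trans hB)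
  push_cast at this
  exact this

lemma BoundedReduced.diag_mono {N : ℕ} {B : ℝ} (hB : 1 ≤ B) {g : ℕ → ℕ → ℝ}
    (hg : ∀ a b, g a b = g b a) (h : BoundedReduced N B g) {a b : ℕ} (hab : a ≤ b)
    (hb : b < N) : g a a ≤ g b b := by
  rcases hab.eq_or_lt with rfl | hab
  · rfl
  · simpa using h.diag_le_add hB hg hab.le hab hb (t := 0) (by simp)

lemma BoundedReduced.two_mul_abs_le {N : ℕ} {B : ℝ} (hB : 1 ≤ B) {g : ℕ → ℕ → ℝ}
    (hg : ∀ a b, g a b = g b a) (h : BoundedReduced N B g) {a b : ℕ} (hab : a < b)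
    (hb : b < N) : 2 * |g a b| ≤ g a a := by
  have h1 := h.diag_le_add hB hg le_rfl hab hb (t := 1) (by simp)
  have h2 := h.diag_le_add hB hg le_rfl hab hb (t := -1) (by simp)
  push_cast at h1 h2
  rcases abs_cases (g a b) with h3 | h3 <;> linarith

/-- The number of pigeonholes per coordinate used to bound the pivots. -/
def holes (N : ℕ) : ℕ := (4 * N) ^ (N + 1)

/-- A lower bound for the ratio of a pivot to the corresponding diagonal entry. -/
noncomputable def pivotRatio (N : ℕ) : ℝ :=
  1 / (2 * ((holes N : ℝ) ^ N) ^ 2 * (4 * N : ℝ) ^ N)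

lemma one_le_holes {N : ℕ} (hN : 0 < N) : 1 ≤ holes N := Nat.one_le_pow _ _ (by omega)

lemma pivotRatio_pos {N : ℕ} (hN : 0 < N) : 0 < pivotRatio N := by
  have := one_le_holes hN
  unfold pivotRatio
  positivity

lemma pivotRatio_mul_le_pivot {N k : ℕ} (hk : k < N) {C B : ℝ} (hC : 0 ≤ C)
    (hB : (holes N : ℝ) ^ N * (2 + C) ^ N ≤ B) {g : ℕ → ℕ → ℝ} (hg : ∀ a b, g a b = g b a)
    (hp : ∀ s < k, 0 < pivot g s ∧ pivot g s ≤ g s s)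
    (hμ : ∀ s < k, ∀ b, s < b → b < k + 1 → |coeff g s b| ≤ C)
    (hpos : ∀ s ≤ k, 0 < g s s) (hmono : ∀ s t, s ≤ t → t ≤ k → g s s ≤ g t t)
    (h : BoundedReduced (k + 1) B g) :
    pivotRatio N * g k k ≤ pivot g k := by
  have hN : 1 ≤ N := by omega
  have hN' : (1 : ℝ) ≤ N := by exact_mod_cast hN
  set r : ℝ := 4 * N with hr
  have hr1 : 1 ≤ r := by linarith
  have hR := one_le_holes hN
  have hR1 : (1 : ℝ) ≤ holes N := by exact_mod_cast hR
  have hRr : (holes N : ℝ) = r ^ (N + 1) := by simp [holes, hr]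
  set Q : ℝ := (holes N : ℝ) ^ N with hQ
  have hQ1 : 1 ≤ Q := one_le_pow₀ hR1
  obtain ⟨m, hmk, hgap, hgk⟩ := exists_gap hr1 k (fun s hs => (hpos s hs).le) hmono
  obtain ⟨v, hv, hvk, hc1, hc2⟩ := exists_primitive_small_coord (coeff g) hmk hR
  have hgm := hpos m hmk
  have hvk : |(v k : ℝ)| ≤ Q := hvk.trans (pow_le_pow_right₀ hR1 hk.le)
  have hRinv : (1 : ℝ) / holes N ≤ 1 := by rw [div_le_one (by linarith)]; exact hR1
  have hck : ∀ s < k + 1, |coord (k + 1) (coeff g) s (fun l => v l)| ≤ Q := by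
    intro s hs
    rcases Nat.lt_succ_iff_lt_or_eq.1 hs with hs | rfl
    · rcases lt_or_ge s m with h1 | h1
      · exact (hc2 s h1).trans hQ1
      · exact (hc1 s h1 hs).trans (hRinv.trans hQ1)
    · simpa [coord] using hvk
  have hvB : ∀ l < k + 1, |(v l : ℝ)| ≤ B := by
    intro l hl
    have := abs_le_of_coord_le hC (by linarith)
      (fun s b h1 h2 => hμ s (by omega) b h1 h2) hck hl
    refine this.trans (le_trans ?_ hB)
    exact mul_le_mul_of_nonneg_left (pow_le_pow_right₀ (by linarith) (by omega)) (by linarith)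
  have hmain := h m (by omega) v hv hvB
  rw [blockForm_succ_eq_sum hg (fun t ht => (hp t ht).1.ne')] at hmain
  have hgk' : g k k ≤ r ^ N * g m m :=
    hgk.trans (mul_le_mul_of_nonneg_right (pow_le_pow_right₀ hr1 hk.le) hgm.le)
  have hterm : ∀ s ∈ Finset.range k,
      pivot g s * coord (k + 1) (coeff g) s (fun l => v l) ^ 2 ≤ g m m / r := by
    intro s hs
    have hs := Finset.mem_range.1 hs
    obtain ⟨hp1, hp2⟩ := hp s hs
    rw [← sq_abs, le_div_iff₀ (by linarith)]
    set x := |coord (k + 1) (coeff g) s (fun l => v l)| with hx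
    have hx0 : 0 ≤ x := abs_nonneg _
    rcases lt_or_ge s m with h1 | h1
    · have h2 : x ^ 2 ≤ 1 := pow_le_one₀ hx0 (hc2 s h1)
      have h3 := hgap s h1
      have h4 : pivot g s * x ^ 2 ≤ g s s := by nlinarith
      nlinarith
    · have h2 : x ^ 2 ≤ (1 / holes N) ^ 2 := pow_le_pow_left₀ hx0 (hc1 s h1 hs) 2
      have h3 : pivot g s ≤ r ^ N * g m m := hp2.trans ((hmono s k hs.le le_rfl).trans hgk')
      have h4 : pivot g s * x ^ 2 ≤ r ^ N * g m m * (1 / holes N) ^ 2 :=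
        mul_le_mul h3 h2 (sq_nonneg _) (hp1.le.trans h3)
      have h5 : r ^ N * g m m * (1 / holes N) ^ 2 * r = g m m / holes N := by
        rw [hRr]; field_simp; ring
      have h6 : g m m / holes N ≤ g m m := div_le_self hgm.le hR1
      have h7 := mul_le_mul_of_nonneg_right h4 (by linarith : 0 ≤ r)
      linarith
  have hsum := Finset.sum_le_card_nsmul _ _ _ hterm
  rw [Finset.card_range, nsmul_eq_mul] at hsum
  have hsum2 : (k : ℝ) * (g m m / r) ≤ g m m / 4 := by
    have : (k : ℝ) ≤ N := by exact_mod_cast hk.le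
    rw [hr, mul_div_assoc', div_le_div_iff₀ (by linarith) (by norm_num)]
    nlinarith
  have hpk : g m m / 2 ≤ pivot g k * (v k : ℝ) ^ 2 := by linarith
  have hvk2 : (v k : ℝ) ^ 2 ≤ Q ^ 2 := by
    rw [← sq_abs]; exact pow_le_pow_left₀ (abs_nonneg _) hvk 2
  have hpk0 : 0 < pivot g k := by
    by_contra! hneg
    nlinarith [sq_nonneg (v k : ℝ)]
  have hpk2 : g m m / 2 ≤ pivot g k * Q ^ 2 :=
    hpk.trans (mul_le_mul_of_nonneg_left hvk2 hpk0.le)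
  have hrN : 0 < r ^ N := by positivity
  rw [pivotRatio, ← hQ, ← hr, div_mul_eq_mul_div, one_mul, div_le_iff₀ (by positivity)]
  nlinarith [mul_le_mul_of_nonneg_left hpk2 hrN.le]

/-- Bounds for the off-diagonal entries of the iterated Schur complements. -/
noncomputable def schurBound (c : ℝ) : ℕ → ℝ
  | 0 => 1
  | s + 1 => schurBound c s + schurBound c s ^ 2 / c

lemma schurBound_mono {c : ℝ} (hc : 0 < c) : Monotone (schurBound c) :=
  monotone_nat_of_le_succ fun s => by
    simp only [schurBound]
    exact le_add_of_nonneg_right (by positivity)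

lemma one_le_schurBound {c : ℝ} (hc : 0 < c) (s : ℕ) : 1 ≤ schurBound c s :=
  schurBound_mono hc (Nat.zero_le s)

lemma BoundedReduced.pivot_bounds {N : ℕ} (hN : 0 < N) {C B : ℝ}
    (hC : schurBound (pivotRatio N) N / pivotRatio N ≤ C) (hB1 : 1 ≤ B)
    (hB : (holes N : ℝ) ^ N * (2 + C) ^ N ≤ B) {g : ℕ → ℕ → ℝ} (hg : ∀ a b, g a b = g b a)
    (h0 : 0 < g 0 0) (h : BoundedReduced N B g) {k : ℕ} (hk : k ≤ N) :
    (∀ s < k, pivotRatio N * g s s ≤ pivot g s ∧ pivot g s ≤ g s s ∧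
      ∀ b, s < b → b < N → |coeff g s b| ≤ C) ∧
    (∀ a b, k ≤ a → a ≤ b → b < N →
      |schur g k a b| ≤ schurBound (pivotRatio N) k * g a a) ∧
    ∀ a, k ≤ a → a < N → schur g k a a ≤ g a a := by
  have hc := pivotRatio_pos hN
  set c := pivotRatio N with hcdef
  have hpos : ∀ s < N, 0 < g s s := fun s hs =>
    h0.trans_le (h.diag_mono hB1 hg (Nat.zero_le s) hs)
  have hC0 : 0 ≤ C := le_trans (by have := one_le_schurBound hc N; positivity) hC
  induction k with
  | zero =>
    refine ⟨by simp, fun a b _ hab hb => ?_, fun a _ _ => le_rfl⟩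
    simp only [schur, schurBound, one_mul]
    rcases hab.eq_or_lt with rfl | hab
    · exact (abs_of_pos (hpos a hb)).le
    · have := h.two_mul_abs_le hB1 hg hab hb
      linarith [abs_nonneg (g a b)]
  | succ k ih =>
    obtain ⟨ih1, ih2, ih3⟩ := ih (by omega)
    have hkN : k < N := hk
    have hgk := hpos k hkN
    have hpk : c * g k k ≤ pivot g k := by
      refine pivotRatio_mul_le_pivot hkN hC0 hB hg (fun s hs => ⟨?_, (ih1 s hs).2.1⟩)
        (fun s hs b h1 h2 => (ih1 s hs).2.2 b h1 (by omega)) (fun s hs => hpos s (by omega))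
        (fun s t h1 h2 => h.diag_mono hB1 hg h1 (by omega)) (h.of_le (by linarith) hk)
      exact (mul_pos hc (hpos s (by omega))).trans_le (ih1 s hs).1
    have hpk0 : 0 < pivot g k := (mul_pos hc hgk).trans_le hpk
    set K := schurBound c k with hK
    have hK1 : 1 ≤ K := one_le_schurBound hc k
    refine ⟨fun s hs => ?_, fun a b hka hab hb => ?_, fun a hka ha => ?_⟩
    · rcases Nat.lt_succ_iff_lt_or_eq.1 hs with hs | rfl
      · exact ih1 s hs
      · refine ⟨hpk, ih3 s le_rfl hkN, fun b h1 h2 => le_trans ?_ hC⟩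
        rw [coeff, abs_div, abs_of_pos hpk0, div_le_div_iff₀ hpk0 hc]
        have h3 := ih2 s b le_rfl h1.le h2
        have h4 : K ≤ schurBound c N := schurBound_mono hc hkN.le
        calc |schur g s s b| * c ≤ K * g s s * c := mul_le_mul_of_nonneg_right h3 hc.le
          _ = K * (c * g s s) := by ring
          _ ≤ schurBound c N * pivot g s := mul_le_mul h4 hpk (by positivity) (by linarith)
    · have h1 := ih2 a b (by omega) hab hb
      have h2 := ih2 k a le_rfl (by omega) (by omega)
      have h3 := ih2 k b le_rfl (by omega) hb
      have h4 : g k k ≤ g a a := h.diag_mono hB1 hg (by omega) (by omega)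
      simp only [schur, schurBound]
      rw [schur_symm hg k a k]
      change |_ - _ / pivot g k| ≤ _
      refine (abs_sub _ _).trans ?_
      rw [add_mul, abs_div, abs_mul, abs_of_pos hpk0]
      refine add_le_add h1 ?_
      rw [← hK, div_mul_eq_mul_div, div_le_div_iff₀ hpk0 hc]
      calc |schur g k k a| * |schur g k k b| * c
          ≤ K * g k k * (K * g k k) * c :=
            mul_le_mul_of_nonneg_right
              (mul_le_mul h2 h3 (abs_nonneg _) (by positivity)) hc.le
        _ = K ^ 2 * g k k * (c * g k k) := by ring
        _ ≤ K ^ 2 * g a a * pivot g k :=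
            mul_le_mul (mul_le_mul_of_nonneg_left h4 (sq_nonneg _)) hpk (by positivity)
              (mul_nonneg (sq_nonneg _) (hgk.le.trans h4))
    · refine le_trans ?_ (ih3 a (by omega) ha)
      simp only [schur]
      rw [schur_symm hg k a k]
      change _ - _ / pivot g k ≤ _
      exact sub_le_self _ (div_nonneg (mul_self_nonneg _) hpk0.le)

/-- For forms with positive first entry, the bounded Minkowski inequalities imply all of them. -/
lemma exists_bound_of_pos {N : ℕ} (hN : 0 < N) :
    ∃ B : ℝ, 1 ≤ B ∧ ∀ g : ℕ → ℕ → ℝ, (∀ a b, g a b = g b a) → 0 < g 0 0 →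
      BoundedReduced N B g → ∀ i < N, ∀ v : ℕ → ℤ, TailPrimitive i N v →
        g i i ≤ blockForm N g (fun l => v l) := by
  have hc := pivotRatio_pos hN
  set c := pivotRatio N with hcdef
  set C := schurBound c N / c with hCdef
  have hC0 : 0 ≤ C := by have := one_le_schurBound hc N; positivity
  have hN1 : (1 : ℝ) ≤ N := by exact_mod_cast hN
  set K : ℝ := 1 + N / c with hK
  have hK1 : 1 ≤ K := le_add_of_nonneg_right (by positivity)
  have hcK : N ≤ c * K ^ 2 := by
    have : c * K = c + N := by rw [hK]; field_simp
    nlinarith [mul_le_mul_of_nonneg_left hK1 (by linarith : 0 ≤ c + N)]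
  have hQ1 : (1 : ℝ) ≤ (holes N : ℝ) ^ N := one_le_pow₀ (by exact_mod_cast one_le_holes hN)
  have hP1 : 1 ≤ (2 + C) ^ N := one_le_pow₀ (by linarith)
  refine ⟨((holes N : ℝ) ^ N + K) * (2 + C) ^ N, by nlinarith, fun g hg h0 h i hi v hv => ?_⟩
  set B := ((holes N : ℝ) ^ N + K) * (2 + C) ^ N with hB
  have hB1 : 1 ≤ B := by nlinarith
  have hBK : K * (2 + C) ^ N ≤ B := by nlinarith
  obtain ⟨hb, -, -⟩ := h.pivot_bounds hN le_rfl hB1 (by nlinarith) hg h0 le_rfl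
  have hpos : ∀ s < N, 0 < g s s := fun s hs =>
    h0.trans_le (h.diag_mono hB1 hg (Nat.zero_le s) hs)
  have hppos : ∀ s < N, 0 < pivot g s := fun s hs => (mul_pos hc (hpos s hs)).trans_le (hb s hs).1
  have hbdd : ∀ w : ℕ → ℤ, (∀ s < N, |coord N (coeff g) s (fun l => w l)| ≤ K) →
      ∀ l < N, |(w l : ℝ)| ≤ B := fun w hw l hl =>
    (abs_le_of_coord_le hC0 (by linarith) (fun s b h1 h2 => (hb s (h1.trans h2)).2.2 b h1 h2)
      hw hl).trans hBK
  by_cases hv1 : ∀ s < N, |coord N (coeff g) s (fun l => v l)| ≤ K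
  · exact h i hi v hv (hbdd v hv1)
  obtain ⟨j, hjN, hj, hjmax⟩ : ∃ j < N, K < |coord N (coeff g) j (fun l => v l)| ∧
      ∀ s < N, j < s → |coord N (coeff g) s (fun l => v l)| ≤ K := by
    push Not at hv1
    classical
    let S := (Finset.range N).filter fun s => K < |coord N (coeff g) s (fun l => v l)|
    have hS : S.Nonempty := by
      obtain ⟨s, h1, h2⟩ := hv1
      exact ⟨s, Finset.mem_filter.2 ⟨Finset.mem_range.2 h1, h2⟩⟩
    have hm := Finset.mem_filter.1 (S.max'_mem hS)
    refine ⟨S.max' hS, Finset.mem_range.1 hm.1, hm.2, fun s h1 h2 => ?_⟩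
    by_contra! h3
    exact h2.not_ge (S.le_max' s (Finset.mem_filter.2 ⟨Finset.mem_range.2 h1, h3⟩))
  have hjterm : N * g j j ≤ pivot g j * coord N (coeff g) j (fun l => v l) ^ 2 := by
    have h1 : K ^ 2 ≤ coord N (coeff g) j (fun l => v l) ^ 2 := by
      rw [← sq_abs (coord N (coeff g) j (fun l => v l))]
      exact pow_le_pow_left₀ (by linarith) hj.le 2
    calc N * g j j ≤ c * K ^ 2 * g j j := mul_le_mul_of_nonneg_right hcK (hpos j hjN).le
      _ = c * g j j * K ^ 2 := by ring
      _ ≤ _ := mul_le_mul (hb j hjN).1 h1 (sq_nonneg _) (hppos j hjN).le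
  have hnn : ∀ s ∈ Finset.range N, 0 ≤ pivot g s * coord N (coeff g) s (fun l => v l) ^ 2 :=
    fun s hs => mul_nonneg (hppos s (Finset.mem_range.1 hs)).le (sq_nonneg _)
  rcases le_or_gt i j with hij | hij
  · rw [blockForm_eq_sum_self hg (fun t ht => (hppos t ht).ne')]
    have h1 := Finset.single_le_sum hnn (Finset.mem_range.2 hjN)
    have h2 := h.diag_mono hB1 hg hij hjN
    have := hpos j hjN
    nlinarith
  · obtain ⟨w, hw, hwc⟩ := exists_rounding N (coeff g) (j + 1) v
    have hweq : ∀ s, j < s →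
        coord N (coeff g) s (fun l => w l) = coord N (coeff g) s (fun l => v l) := fun s hs =>
      coord_congr fun l hl => by rw [hw l (by omega)]
    have hwK : ∀ s < N, |coord N (coeff g) s (fun l => w l)| ≤ K := by
      intro s hs
      rcases lt_or_ge j s with h1 | h1
      · rw [hweq s h1]
        exact hjmax s hs h1
      · have := hwc s (by omega)
        rw [abs_of_nonneg this.1]
        exact this.2.le.trans hK1
    refine (h i hi w (hv.congr fun l h1 _ => (hw l (by omega)).symm) (hbdd w hwK)).trans ?_
    rw [blockForm_eq_sum_self hg (fun t ht => (hppos t ht).ne'),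
      blockForm_eq_sum_self hg (fun t ht => (hppos t ht).ne'), Finset.range_eq_Ico,
      ← Finset.sum_Ico_consecutive _ (Nat.zero_le (j + 1)) hjN,
      ← Finset.sum_Ico_consecutive _ (Nat.zero_le (j + 1)) hjN]
    refine add_le_add ?_ (Finset.sum_congr rfl fun s hs => ?_).le
    · have h1 : ∀ s ∈ Finset.Ico 0 (j + 1),
          pivot g s * coord N (coeff g) s (fun l => w l) ^ 2 ≤ g j j := by
        intro s hs
        have hs := (Finset.mem_Ico.1 hs).2
        obtain ⟨h1, h2⟩ := hwc s hs
        have h3 : coord N (coeff g) s (fun l => w l) ^ 2 ≤ 1 := pow_le_one₀ h1 h2.le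
        have h4 := (hb s (by omega)).2.1
        have h5 : g s s ≤ g j j := h.diag_mono hB1 hg (by omega) hjN
        have h6 := hppos s (by omega)
        nlinarith
      have h2 := Finset.sum_le_card_nsmul _ _ _ h1
      rw [Nat.card_Ico, nsmul_eq_mul] at h2
      have h3 : ((j + 1 - 0 : ℕ) : ℝ) ≤ N := by exact_mod_cast hjN
      refine (h2.trans (mul_le_mul_of_nonneg_right h3 (hpos j hjN).le)).trans (hjterm.trans ?_)
      exact Finset.single_le_sum
        (f := fun s => pivot g s * coord N (coeff g) s (fun l => v l) ^ 2)
        (fun s hs => hnn s (Finset.mem_range.2 (by have := Finset.mem_Ico.1 hs; omega)))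
        (Finset.mem_Ico.2 ⟨Nat.zero_le j, by omega⟩)
    · rw [hweq s (by have := Finset.mem_Ico.1 hs; omega)]

lemma blockForm_add_identity (N : ℕ) (g : ℕ → ℕ → ℝ) (t : ℝ) (x : ℕ → ℝ) :
    blockForm N (fun a b => g a b + if a = b then t else 0) x =
      blockForm N g x + t * ∑ l ∈ Finset.range N, x l ^ 2 := by
  rw [blockForm, blockForm, Finset.mul_sum, ← Finset.sum_add_distrib]
  refine Finset.sum_congr rfl fun a ha => ?_
  simp only [add_mul, Finset.sum_add_distrib, ite_mul, zero_mul, Finset.sum_ite_eq, ha, if_true]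
  ring

lemma TailPrimitive.one_le_sum_sq {i N : ℕ} {v : ℕ → ℤ} (hv : TailPrimitive i N v) :
    (1 : ℝ) ≤ ∑ l ∈ Finset.range N, (v l : ℝ) ^ 2 := by
  obtain ⟨l, hl, hvl⟩ : ∃ l < N, v l ≠ 0 := by
    by_contra! h0
    have := hv 0 fun l _ h2 => by rw [h0 l h2]
    norm_num at this
  refine le_trans ?_ (Finset.single_le_sum (fun l _ => sq_nonneg (v l : ℝ))
    (Finset.mem_range.2 hl))
  rw [one_le_sq_iff_one_le_abs]
  exact_mod_cast Int.one_le_abs hvl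

lemma exists_bound {N : ℕ} (hN : 0 < N) :
    ∃ B : ℝ, ∀ g : ℕ → ℕ → ℝ, (∀ a b, g a b = g b a) →
      BoundedReduced N B g → ∀ i < N, ∀ v : ℕ → ℤ, TailPrimitive i N v →
        g i i ≤ blockForm N g (fun l => v l) := by
  obtain ⟨B, hB1, hB⟩ := exists_bound_of_pos hN
  refine ⟨B, fun g hg h i hi v hv => ?_⟩
  rcases (show N = 1 ∨ 1 < N by omega) with rfl | hN1
  · obtain rfl : i = 0 := by omega
    refine h 0 hi v hv fun l hl => le_trans ?_ hB1
    obtain rfl : l = 0 := by omega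
    have h1 := hv (v 0) fun l _ h2 => by rw [show l = 0 by omega]
    rcases Int.isUnit_iff.1 (isUnit_of_dvd_one h1) with h2 | h2 <;> simp [h2]
  · have h00 : 0 ≤ g 0 0 := le_trans (by positivity) (h.two_mul_abs_le hB1 hg zero_lt_one hN1)
    set S := ∑ l ∈ Finset.range N, (v l : ℝ) ^ 2 with hS
    have hS0 : 0 ≤ S := Finset.sum_nonneg fun _ _ => sq_nonneg _
    have key : ∀ t > 0, g i i + t ≤ blockForm N g (fun l => v l) + t * S := by
      intro t ht
      have := hB (fun a b => g a b + if a = b then t else 0)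
        (fun a b => by simp only [hg a b, eq_comm])
        (by simpa using add_pos_of_nonneg_of_pos h00 ht) (fun j hj w hw hwB => ?_) i hi v hv
      · simpa [blockForm_add_identity] using this
      · rw [blockForm_add_identity]
        have h1 := hw.one_le_sum_sq
        have h2 := h j hj w hw hwB
        simp only [if_true]
        nlinarith
    by_contra! hlt
    have h1 := key ((g i i - blockForm N g (fun l => v l)) / (S + 1))
      (div_pos (by linarith) (by linarith))
    have h2 : (g i i - blockForm N g (fun l => v l)) / (S + 1) * (S + 1)
        = g i i - blockForm N g (fun l => v l) := by field_simp
    have h3 : 0 < (g i i - blockForm N g (fun l => v l)) / (S + 1) :=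
      div_pos (by linarith) (by linarith)
    nlinarith

/-- Extension of a matrix by zero to natural number indices. -/
def extendMatrix {N : ℕ} (G : Matrix (Fin N) (Fin N) ℝ) (a b : ℕ) : ℝ :=
  if h : a < N ∧ b < N then G ⟨a, h.1⟩ ⟨b, h.2⟩ else 0

lemma extendMatrix_val {N : ℕ} (G : Matrix (Fin N) (Fin N) ℝ) (a b : Fin N) :
    extendMatrix G a b = G a b := by simp [extendMatrix]

lemma blockForm_extendMatrix {N : ℕ} (G : Matrix (Fin N) (Fin N) ℝ) (v : ℕ → ℤ) :
    blockForm N (extendMatrix G) (fun l => v l) = intQuadForm G (fun l => v l) := by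
  simp only [blockForm, intQuadForm, dotProduct, mulVec, Finset.sum_range, extendMatrix_val,
    Finset.mul_sum]
  exact Finset.sum_congr rfl fun a _ => Finset.sum_congr rfl fun b _ => by ring

lemma gcdTailOne_iff {N : ℕ} (i : Fin N) (v : ℕ → ℤ) :
    GcdTailOne i (fun l => v l) ↔ TailPrimitive i N v := by
  rw [tailPrimitive_iff_gcd, GcdTailOne, ← Fin.map_valEmbedding_Ici, Finset.map_eq_image,
    Finset.gcd_image]
  rfl

end MinkowskiReduction

/-- the Minkowski reduction region is a polyhedral cone: finitely
many of the inequalities `vᵀGv ≥ g_{i,i}` suffice to describe it. -/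
theorem minkowski_region_polyhedral (N : ℕ) :
    ∃ T : Finset (Fin N × (Fin N → ℤ)),
      (∀ p ∈ T, GcdTailOne p.1 p.2) ∧
      MinkowskiRegion N =
        {G | G.IsSymm ∧
          (∀ p ∈ T, G p.1 p.1 ≤ intQuadForm G p.2) ∧
          (∀ i : Fin N, ∀ h : (i : ℕ) + 1 < N, 0 ≤ G i ⟨(i : ℕ) + 1, h⟩)} := by
  rcases Nat.eq_zero_or_pos N with rfl | hN
  · refine ⟨∅, by simp, ?_⟩
    ext G
    simp [MinkowskiRegion]
  obtain ⟨B, hB⟩ := MinkowskiReduction.exists_bound hN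
  have hfin : {p : Fin N × (Fin N → ℤ) |
      GcdTailOne p.1 p.2 ∧ ∀ l, |(p.2 l : ℝ)| ≤ B}.Finite := by
    refine (Set.finite_univ.prod (Set.finite_Icc (fun _ : Fin N => -⌈B⌉) fun _ => ⌈B⌉)).subset ?_
    rintro ⟨i, v⟩ ⟨-, hv⟩
    have hle : ∀ l, |v l| ≤ ⌈B⌉ := fun l => by exact_mod_cast (hv l).trans (Int.le_ceil B)
    exact ⟨Set.mem_univ _, fun l => (abs_le.1 (hle l)).1, fun l => (abs_le.1 (hle l)).2⟩
  refine ⟨hfin.toFinset, fun p hp => (hfin.mem_toFinset.1 hp).1, ?_⟩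
  ext G
  constructor
  · rintro ⟨hs, hG, hnn⟩
    exact ⟨hs, fun p hp => hG _ _ (hfin.mem_toFinset.1 hp).1, hnn⟩
  · rintro ⟨hs, hG, hnn⟩
    refine ⟨hs, fun i v hv => ?_, hnn⟩
    obtain ⟨w, rfl⟩ : ∃ w : ℕ → ℤ, v = fun l : Fin N => w l :=
      ⟨fun l => if h : l < N then v ⟨l, h⟩ else 0, by ext l; simp⟩
    have key := hB (MinkowskiReduction.extendMatrix G) (fun a b => ?_) (fun j hj u hu huB => ?_)
      i i.2 w ((MinkowskiReduction.gcdTailOne_iff i w).1 hv)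
    · rwa [MinkowskiReduction.blockForm_extendMatrix, MinkowskiReduction.extendMatrix_val] at key
    · unfold MinkowskiReduction.extendMatrix
      by_cases h : a < N ∧ b < N
      · rw [dif_pos h, dif_pos h.symm, hs.apply]
      · rw [dif_neg h, dif_neg fun h' => h h'.symm]
    · rw [MinkowskiReduction.blockForm_extendMatrix]
      refine (MinkowskiReduction.extendMatrix_val G ⟨j, hj⟩ ⟨j, hj⟩).trans_le ?_
      exact hG (⟨j, hj⟩, fun l => u l) (hfin.mem_toFinset.2
        ⟨(MinkowskiReduction.gcdTailOne_iff ⟨j, hj⟩ u).2 hu, fun l => huB l l.2⟩)
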